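/- Let e ≤ n and let C ⊆ ℝ^n be a bounded semialgebraic set. If dim(C) < e, then H^e(C) = 0, where dim is the semialgebraic dimension and H^e the e-dimensional Hausdorff measure. Moreover, if C is bounded semialgebraic with dim(C) ≤ e, then H^e(C) < ∞. -/

import Mathlib

open MeasureTheory Set ENNReal
noncomputable section

abbrev E (n : ℕ) := EuclideanSpace ℝ (Fin n)

/-- Semialgebraic subsets of ℝ^n: the boolean algebra generated by sets of the
form {x : p(x) ≥ 0} for real polynomials p. -/
inductive IsSemialgebraic (n : ℕ) : Set (E n) → Prop
  | basic (p : MvPolynomial (Fin n) ℝ) :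
      IsSemialgebraic n {x | 0 ≤ MvPolynomial.eval (fun i => x i) p}
  | compl {s : Set (E n)} : IsSemialgebraic n s → IsSemialgebraic n sᶜ
  | union {s t : Set (E n)} :
      IsSemialgebraic n s → IsSemialgebraic n t → IsSemialgebraic n (s ∪ t)

/-- The dimension of a set C ⊆ ℝ^n: the maximal d such that C contains a
C¹-diffeomorphic (injective immersive) image of a nonempty open subset of ℝ^d. -/
def sDim {n : ℕ} (C : Set (E n)) : ℕ :=
  sSup {d : ℕ | ∃ U : Set (E d), IsOpen U ∧ U.Nonempty ∧
    ∃ g : E d → E n, ContDiffOn ℝ 1 g U ∧ Set.InjOn g U ∧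
      (∀ x ∈ U, Function.Injective (fderiv ℝ g x)) ∧ g '' U ⊆ C}

namespace Semialg

open Filter Topology

variable {n k d : ℕ} {ι : Type*}

/-- Evaluation of a polynomial at a point of Euclidean space. -/
def polyEval (p : MvPolynomial (Fin n) ℝ) (x : E n) : ℝ := MvPolynomial.eval (fun i => x i) p

/-- The map between real spaces with polynomial components `F`. -/
def polyMap (F : ι → MvPolynomial (Fin n) ℝ) (x : E n) : ι → ℝ := fun i => polyEval (F i) x

/-- The `j`-th coordinate as a continuous linear form. -/
def coordL (j : Fin n) : E n →L[ℝ] ℝ := EuclideanSpace.proj j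

@[simp] lemma coordL_apply (j : Fin n) (x : E n) : coordL j x = x j := rfl

/-- The differential of a polynomial. -/
def grad (p : MvPolynomial (Fin n) ℝ) (x : E n) : E n →L[ℝ] ℝ :=
  ∑ j, polyEval (MvPolynomial.pderiv j p) x • coordL j

/-- The differential of `polyMap F`. -/
def jac [Fintype ι] (F : ι → MvPolynomial (Fin n) ℝ) (x : E n) : E n →L[ℝ] (ι → ℝ) :=
  ContinuousLinearMap.pi fun i => grad (F i) x

lemma grad_apply (p : MvPolynomial (Fin n) ℝ) (x v : E n) :
    grad p x v = ∑ j, polyEval (MvPolynomial.pderiv j p) x * v j := by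
  simp [grad]

lemma grad_X (j : Fin n) (x v : E n) : grad (MvPolynomial.X j) x v = v j := by
  classical
  rw [grad_apply, Finset.sum_eq_single j]
  · simp [polyEval]
  · intro b _ hb
    simp [polyEval, MvPolynomial.pderiv_X_of_ne hb.symm]
  · simp

lemma jac_apply [Fintype ι] (F : ι → MvPolynomial (Fin n) ℝ) (x v : E n) (i : ι) :
    jac F x v i = grad (F i) x v := rfl

lemma contDiff_polyEval (p : MvPolynomial (Fin n) ℝ) : ContDiff ℝ 1 (polyEval p) := by
  unfold polyEval
  induction p using MvPolynomial.induction_on with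
  | C a => simpa using contDiff_const
  | add p q hp hq => simpa using hp.add hq
  | mul_X p i hp =>
    simpa using hp.mul
      (coordL i).contDiff

lemma hasFDerivAt_polyEval (p : MvPolynomial (Fin n) ℝ) (x : E n) :
    HasFDerivAt (polyEval p) (grad p x) x := by
  unfold polyEval
  induction p using MvPolynomial.induction_on with
  | C a =>
    have : grad (MvPolynomial.C a) x = 0 := by ext v; simp [grad_apply, polyEval]
    simpa [this] using hasFDerivAt_const a x
  | add p q hp hq =>
    have : grad (p + q) x = grad p x + grad q x := by
      ext v; simp [grad_apply, polyEval, add_mul, Finset.sum_add_distrib]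
    simpa [this] using! hp.add hq
  | mul_X p i hp =>
    have h := hp.mul (coordL i).hasFDerivAt (x := x)
    have e : grad (p * MvPolynomial.X i) x = (MvPolynomial.eval fun j => x j) p •
        (coordL i) + x i • grad p x := by
      ext v
      have := grad_X i x v
      rw [grad_apply] at this
      simp only [add_apply, smul_apply, grad_apply,
        coordL_apply, smul_eq_mul]
      rw [← this, Finset.mul_sum, Finset.mul_sum, ← Finset.sum_add_distrib]
      refine Finset.sum_congr rfl fun j _ => ?_
      simp [polyEval, Derivation.leibniz]
      ring
    rw [e]
    simpa using! h

lemma continuous_polyEval (p : MvPolynomial (Fin n) ℝ) : Continuous (polyEval p) :=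
  (contDiff_polyEval p).continuous

lemma contDiff_polyMap [Fintype ι] (F : ι → MvPolynomial (Fin n) ℝ) : ContDiff ℝ 1 (polyMap F) :=
  contDiff_pi.2 fun i => contDiff_polyEval (F i)

lemma hasFDerivAt_polyMap [Fintype ι] (F : ι → MvPolynomial (Fin n) ℝ) (x : E n) :
    HasFDerivAt (polyMap F) (jac F x) x :=
  hasFDerivAt_pi.2 fun i => hasFDerivAt_polyEval (F i) x

lemma hasStrictFDerivAt_polyMap [Fintype ι] (F : ι → MvPolynomial (Fin n) ℝ) (x : E n) :
    HasStrictFDerivAt (polyMap F) (jac F x) x :=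
  (contDiff_polyMap F).contDiffAt.hasStrictFDerivAt' (hasFDerivAt_polyMap F x) one_ne_zero

/-- The Jacobian minor of `f` on the columns `ρ`. -/
def minor (f : Fin k → MvPolynomial (Fin n) ℝ) (ρ : Fin k → Fin n) : MvPolynomial (Fin n) ℝ :=
  (Matrix.of fun i j => MvPolynomial.pderiv (ρ j) (f i)).det

lemma polyEval_minor (f : Fin k → MvPolynomial (Fin n) ℝ) (ρ : Fin k → Fin n) (x : E n) :
    polyEval (minor f ρ) x =
      (Matrix.of fun i j => polyEval (MvPolynomial.pderiv (ρ j) (f i)) x).det := by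
  unfold polyEval minor
  rw [RingHom.map_det]
  rfl

lemma minor_injective {f : Fin k → MvPolynomial (Fin n) ℝ} {ρ : Fin k → Fin n}
    (h : minor f ρ ≠ 0) : Function.Injective ρ := by
  intro i j hij
  by_contra hne
  exact h (Matrix.det_zero_of_column_eq hne fun l => by simp [hij])

/-- Expansion of bordered Jacobian minors along a tangent vector. -/
lemma sum_mul_minor_snoc (f : Fin k → MvPolynomial (Fin n) ℝ) (ρ : Fin k → Fin n)
    (h : MvPolynomial (Fin n) ℝ) (y v : E n) (hv : jac f y v = 0) :
    ∑ j, v j * polyEval (minor (Fin.snoc f h : Fin (k + 1) → MvPolynomial (Fin n) ℝ)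
      (Fin.snoc ρ j : Fin (k + 1) → Fin n)) y = polyEval (minor f ρ) y * grad h y v := by
  simp only [polyEval_minor]
  simp_rw [Matrix.det_succ_column _ (Fin.last k), Finset.mul_sum]
  rw [Finset.sum_comm, Fin.sum_univ_castSucc, Finset.sum_eq_zero, zero_add]
  · simp only [Matrix.of_apply, Fin.snoc_last, Fin.succAbove_last, Matrix.submatrix,
      Fin.snoc_castSucc, grad_apply, Finset.mul_sum]
    refine Finset.sum_congr rfl fun j _ => ?_
    rw [Even.neg_one_pow ⟨_, rfl⟩]
    ring
  · intro i _
    have hi : grad (f i) y v = 0 := congrFun hv i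
    rw [grad_apply] at hi
    simp only [Matrix.of_apply, Fin.snoc_last, Fin.succAbove_last, Matrix.submatrix,
      Fin.snoc_castSucc]
    have : ∀ (c D : ℝ), (∑ j, v j * (c * polyEval (MvPolynomial.pderiv j (f i)) y * D)) = 0 := by
      intro c D
      rw [← mul_zero (c * D), ← hi, Finset.mul_sum]
      exact Finset.sum_congr rfl fun j _ => by ring
    exact this _ _

/-- Cramer's rule for tangent vectors. -/
lemma minor_mul_tangent (f : Fin k → MvPolynomial (Fin n) ℝ) (ρ : Fin k → Fin n)
    (σ : Fin d → Fin n) (hb : Function.Bijective (Sum.elim ρ σ)) (y v : E n)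
    (hv : jac f y v = 0) (i : Fin k) :
    polyEval (minor f ρ) y * v (ρ i) =
      - ∑ m, v (σ m) * polyEval (minor f (Function.update ρ i (σ m))) y := by
  set A : Matrix (Fin k) (Fin k) ℝ :=
    Matrix.of fun i j => polyEval (MvPolynomial.pderiv (ρ j) (f i)) y with hA
  have hupd : ∀ m, polyEval (minor f (Function.update ρ i (σ m))) y =
      Matrix.cramer A (fun l => polyEval (MvPolynomial.pderiv (σ m) (f l)) y) i := by
    intro m
    rw [polyEval_minor, Matrix.cramer_apply]
    congr 1
    ext l j
    by_cases hj : j = i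
    · subst hj; simp
    · simp [hj, hA]
  have hAv : A.mulVec (fun j => v (ρ j)) =
      - ∑ m, v (σ m) • (fun l => polyEval (MvPolynomial.pderiv (σ m) (f l)) y) := by
    ext l
    have hl : grad (f l) y v = 0 := congrFun hv l
    rw [grad_apply, ← (Equiv.ofBijective _ hb).sum_comp, Fintype.sum_sum_type] at hl
    simp only [Equiv.ofBijective_apply, Sum.elim_inl, Sum.elim_inr] at hl
    simp only [Matrix.mulVec, dotProduct, hA, Matrix.of_apply, Pi.neg_apply, Finset.sum_apply,
      Pi.smul_apply, smul_eq_mul]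
    rw [eq_neg_iff_add_eq_zero, ← hl]
    congr 1
    exact Finset.sum_congr rfl fun j _ => by ring
  have h1 : Matrix.cramer A (A.mulVec (fun j => v (ρ j))) = A.det • fun j => v (ρ j) := by
    rw [Matrix.cramer_eq_adjugate_mulVec, Matrix.mulVec_mulVec, Matrix.adjugate_mul,
      Matrix.smul_mulVec, Matrix.one_mulVec]
  have h2 := congrFun h1 i
  rw [hAv, map_neg, map_sum] at h2
  simp only [map_smul, Pi.neg_apply, Finset.sum_apply, Pi.smul_apply, smul_eq_mul] at h2
  rw [polyEval_minor, ← hA, ← h2]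
  simp only [hupd]

lemma exists_complement (ρ : Fin k → Fin n) (hρ : Function.Injective ρ) :
    ∃ σ : Fin (n - k) → Fin n, Function.Bijective (Sum.elim ρ σ) := by
  classical
  have hc : Fintype.card {j // j ∉ Set.range ρ} = n - k := by
    rw [Fintype.card_subtype_compl]
    have : Fintype.card {j // j ∈ Set.range ρ} = k := by
      rw [← Fintype.card_congr (Equiv.ofInjective ρ hρ), Fintype.card_fin]
    simp only [this, Fintype.card_fin]
  let e := (Fintype.equivFinOfCardEq hc).symm
  refine ⟨fun m => (e m : Fin n), ?_, ?_⟩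
  · refine Function.Injective.sumElim hρ (Subtype.val_injective.comp e.injective) ?_
    intro a b hab
    exact (e b).2 ⟨a, hab⟩
  · intro j
    by_cases hj : j ∈ Set.range ρ
    · obtain ⟨i, rfl⟩ := hj
      exact ⟨Sum.inl i, rfl⟩
    · exact ⟨Sum.inr (e.symm ⟨j, hj⟩), by simp⟩

lemma exists_equiv_jac [Fintype ι] (hι : Fintype.card ι = n) (F : ι → MvPolynomial (Fin n) ℝ)
    (x : E n) (hx : Function.Injective (jac F x)) :
    ∃ e : E n ≃L[ℝ] (ι → ℝ), (e : E n →L[ℝ] (ι → ℝ)) = jac F x := by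
  have hfr : Module.finrank ℝ (E n) = Module.finrank ℝ (ι → ℝ) := by simp [hι]
  refine ⟨(LinearEquiv.ofBijective (jac F x).toLinearMap ⟨hx,
    (LinearMap.injective_iff_surjective_of_finrank_eq_finrank hfr).1 hx⟩).toContinuousLinearEquiv,
    ?_⟩
  ext v
  rfl

/-- Each coordinate is algebraic over `n` polynomials, in the sense of a nontrivial polynomial
relation. -/
lemma exists_relation [Fintype ι] (hι : Fintype.card ι = n) (F : ι → MvPolynomial (Fin n) ℝ)
    (j : Fin n) :
    ∃ Q : Polynomial (MvPolynomial ι ℝ), Q ≠ 0 ∧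
      ∀ x : E n, Polynomial.eval (x j) (Q.map (MvPolynomial.eval (polyMap F x))) = 0 := by
  have hdep : ¬ AlgebraicIndependent ℝ
      (fun o : Option ι => o.elim (MvPolynomial.X j : MvPolynomial (Fin n) ℝ) F) := by
    intro h
    have := h.lift_cardinalMk_le_trdeg
    rw [MvPolynomial.trdeg_of_isDomain] at this
    simp only [Cardinal.mk_fintype, Fintype.card_option, hι, Fintype.card_fin,
      Cardinal.lift_natCast] at this
    exact absurd (Nat.cast_le.1 this) (by omega)
  rw [algebraicIndependent_iff] at hdep
  push Not at hdep
  obtain ⟨P, hP, hP0⟩ := hdep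
  refine ⟨MvPolynomial.optionEquivLeft ℝ ι P, by simpa using hP0, fun x => ?_⟩
  rw [← MvPolynomial.optionEquivLeft_elim_eval]
  have h := congrArg (MvPolynomial.aeval fun i => x i) hP
  rw [MvPolynomial.comp_aeval_apply, map_zero] at h
  rw [← h, MvPolynomial.coe_aeval_eq_eval .. |>.symm]
  simp only [MvPolynomial.aeval_eq_eval, RingHom.coe_coe]
  congr 2
  funext o
  cases o <;> simp [polyMap, polyEval]

lemma exists_eval_ne_zero [Finite ι] {p : MvPolynomial ι ℝ} (hp : p ≠ 0) {c : ι → ℝ}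
    {U : Set (ι → ℝ)} (hU : U ∈ 𝓝 c) : ∃ t ∈ U, MvPolynomial.eval t p ≠ 0 := by
  cases nonempty_fintype ι
  obtain ⟨r, hr, hU⟩ := Metric.mem_nhds_iff.1 hU
  by_contra! h
  refine hp (MvPolynomial.funext_set (fun i => Metric.ball (c i) r) (fun i => ?_) fun x hx => ?_)
  · rw [Real.ball_eq_Ioo]
    exact Set.Ioo_infinite (by linarith)
  · rw [map_zero]
    exact h x (hU (by rwa [ball_pi _ hr]))

/-- The nondegenerate fibres of a polynomial map between spaces of the same dimension have
uniformly bounded cardinality. -/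
lemma exists_fiber_bound [Fintype ι] (hι : Fintype.card ι = n)
    (F : ι → MvPolynomial (Fin n) ℝ) :
    ∃ N : ℕ, ∀ (c : ι → ℝ) (s : Finset (E n)),
      (∀ x ∈ s, polyMap F x = c ∧ Function.Injective (jac F x)) → s.card ≤ N := by
  classical
  choose Q hQ0 hQ using exists_relation hι F
  refine ⟨∏ j, (Q j).natDegree, fun c s hs => ?_⟩
  obtain ⟨V, hV, hVd⟩ := s.finite_toSet.t2_separation
  have hnhds : (⋂ x ∈ s, polyMap F '' V x) ∈ 𝓝 c := by
    rw [Filter.biInter_finset_mem]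
    intro x hx
    obtain ⟨e, he⟩ := exists_equiv_jac hι F x (hs x hx).2
    have h := hasStrictFDerivAt_polyMap F x
    rw [← he] at h
    rw [← (hs x hx).1, ← h.map_nhds_eq_of_equiv]
    exact Filter.image_mem_map ((hV x).2.mem_nhds (hV x).1)
  obtain ⟨t, ht, hne⟩ := exists_eval_ne_zero
    (Finset.prod_ne_zero_iff.2 fun j (_ : j ∈ Finset.univ) =>
      Polynomial.leadingCoeff_ne_zero.2 (hQ0 j)) hnhds
  rw [map_prod, Finset.prod_ne_zero_iff] at hne
  simp only [Set.mem_iInter] at ht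
  choose! g hg using ht
  let R : Fin n → Finset ℝ := fun j => ((Q j).map (MvPolynomial.eval t)).roots.toFinset
  have hmem : ∀ x ∈ s, (fun j => g x j) ∈ Fintype.piFinset R := by
    intro x hx
    rw [Fintype.mem_piFinset]
    intro j
    have h0 : (Q j).map (MvPolynomial.eval t) ≠ 0 := by
      intro h
      apply hne j (Finset.mem_univ j)
      have := congrArg (fun p => p.coeff (Q j).natDegree) h
      simpa using this
    simp only [R, Multiset.mem_toFinset, Polynomial.mem_roots h0, Polynomial.IsRoot.def]
    rw [← (hg x hx).2]
    exact hQ j _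
  have hinj : Set.InjOn (fun x j => g x j) (s : Set (E n)) := by
    intro x hx y hy hxy
    by_contra hne
    refine Set.disjoint_left.1 (hVd hx hy hne) (hg x hx).1 ?_
    have : g x = g y := by ext j; exact congrFun hxy j
    rw [this]
    exact (hg y hy).1
  calc s.card ≤ (Fintype.piFinset R).card := Finset.card_le_card_of_injOn _ hmem hinj
    _ = ∏ j, (R j).card := Fintype.card_piFinset _
    _ ≤ _ := Finset.prod_le_prod' fun j _ =>
      (Multiset.toFinset_card_le _).trans
        ((Polynomial.card_roots' _).trans Polynomial.natDegree_map_le)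

lemma hausdorffMeasure_le_image_of_dist_le {X Y : Type*} [MetricSpace X] [MeasurableSpace X]
    [BorelSpace X] [MetricSpace Y] [MeasurableSpace Y] [BorelSpace Y] {p : X → Y} {s : Set X}
    {C : NNReal} (h : ∀ a ∈ s, ∀ b ∈ s, dist a b ≤ C * dist (p a) (p b)) {r : ℝ} (hr : 0 ≤ r) :
    μH[r] s ≤ (C : ℝ≥0∞) ^ r * μH[r] (p '' s) := by
  rcases s.eq_empty_or_nonempty with rfl | ⟨x₀, -⟩
  · simp
  have : Nonempty X := ⟨x₀⟩
  have hinj : Set.InjOn p s := fun a ha b hb hab => by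
    have := h a ha b hb
    rw [hab, dist_self, mul_zero] at this
    exact dist_le_zero.1 this
  have hl : LipschitzOnWith C (Function.invFunOn p s) (p '' s) := by
    refine LipschitzOnWith.of_dist_le_mul ?_
    rintro _ ⟨a, ha, rfl⟩ _ ⟨b, hb, rfl⟩
    rw [hinj.leftInvOn_invFunOn ha, hinj.leftInvOn_invFunOn hb]
    exact h a ha b hb
  have := hl.hausdorffMeasure_image_le hr
  rwa [hinj.invFunOn_image subset_rfl] at this

/-- The coordinate projection along `σ`. -/
def proj (σ : Fin d → Fin n) : E n →L[ℝ] (Fin d → ℝ) :=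
  ContinuousLinearMap.pi fun m => coordL (σ m)

@[simp] lemma proj_apply (σ : Fin d → Fin n) (v : E n) (m : Fin d) : proj σ v m = v (σ m) := rfl

lemma norm_proj_le (σ : Fin d → Fin n) (v : E n) : ‖proj σ v‖ ≤ ‖v‖ :=
  (pi_norm_le_iff_of_nonneg (norm_nonneg v)).2 fun m => PiLp.norm_apply_le v (σ m)

/-- The system `f` completed by the coordinates `σ`. -/
def completed (f : Fin k → MvPolynomial (Fin n) ℝ) (σ : Fin d → Fin n) :
    Fin k ⊕ Fin d → MvPolynomial (Fin n) ℝ :=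
  Sum.elim f fun m => MvPolynomial.X (σ m)

lemma polyMap_completed (f : Fin k → MvPolynomial (Fin n) ℝ) (σ : Fin d → Fin n) (x : E n) :
    polyMap (completed f σ) x = Sum.elim (polyMap f x) (proj σ x) := by
  funext i
  cases i <;> simp [completed, polyMap, polyEval]

lemma jac_completed (f : Fin k → MvPolynomial (Fin n) ℝ) (σ : Fin d → Fin n) (x v : E n) :
    jac (completed f σ) x v = Sum.elim (jac f x v) (proj σ v) := by
  funext i
  cases i <;> simp [completed, jac_apply, grad_X]

variable {f : Fin k → MvPolynomial (Fin n) ℝ} {ρ : Fin k → Fin n} {σ : Fin d → Fin n}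

lemma jac_completed_injective (hb : Function.Bijective (Sum.elim ρ σ)) {y : E n}
    (hy : polyEval (minor f ρ) y ≠ 0) : Function.Injective (jac (completed f σ) y) := by
  rw [injective_iff_map_eq_zero]
  intro v hv
  rw [jac_completed] at hv
  have h1 : jac f y v = 0 := funext fun i => congrFun hv (Sum.inl i)
  have h2 : ∀ m, v (σ m) = 0 := fun m => congrFun hv (Sum.inr m)
  ext j
  obtain ⟨i | m, rfl⟩ := hb.2 j
  · have := minor_mul_tangent f ρ σ hb y v h1 i
    simp only [h2, zero_mul, Finset.sum_const_zero, neg_zero, mul_eq_zero, hy, false_or] at this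
    exact this
  · exact h2 m

lemma norm_tangent_le (hb : Function.Bijective (Sum.elim ρ σ)) {y v : E n}
    (hy : polyEval (minor f ρ) y ≠ 0)
    (hmax : ∀ τ, |polyEval (minor f τ) y| ≤ |polyEval (minor f ρ) y|) (hv : jac f y v = 0) :
    ‖v‖ ≤ ((k + 1) * d : ℝ) * ‖proj σ v‖ := by
  have hσ : ∑ m, |v (σ m)| ≤ d * ‖proj σ v‖ := by
    calc ∑ m, |v (σ m)| ≤ ∑ _m : Fin d, ‖proj σ v‖ :=
          Finset.sum_le_sum fun m _ => norm_le_pi_norm (proj σ v) m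
      _ = d * ‖proj σ v‖ := by simp
  have hρ : ∀ i, |v (ρ i)| ≤ ∑ m, |v (σ m)| := by
    intro i
    have h := congrArg abs (minor_mul_tangent f ρ σ hb y v hv i)
    rw [abs_mul, abs_neg] at h
    refine le_of_mul_le_mul_left ?_ (abs_pos.2 hy)
    rw [h, Finset.mul_sum]
    refine (Finset.abs_sum_le_sum_abs _ _).trans (Finset.sum_le_sum fun m _ => ?_)
    rw [abs_mul, mul_comm]
    exact mul_le_mul_of_nonneg_right (hmax _) (abs_nonneg _)
  have hn : ‖v‖ ≤ ∑ j, |v j| := by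
    rw [EuclideanSpace.norm_eq]
    refine Real.sqrt_le_iff.2 ⟨Finset.sum_nonneg fun _ _ => abs_nonneg _, ?_⟩
    exact Finset.sum_sq_le_sq_sum_of_nonneg fun _ _ => abs_nonneg _
  rw [← (Equiv.ofBijective _ hb).sum_comp, Fintype.sum_sum_type] at hn
  simp only [Equiv.ofBijective_apply, Sum.elim_inl, Sum.elim_inr] at hn
  have h3 : ∑ i, |v (ρ i)| ≤ k * ∑ m, |v (σ m)| := by
    calc ∑ i, |v (ρ i)| ≤ ∑ _i : Fin k, ∑ m, |v (σ m)| := Finset.sum_le_sum fun i _ => hρ i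
      _ = _ := by simp
  have hk : (0 : ℝ) ≤ k := Nat.cast_nonneg k
  nlinarith

lemma card_eq (hb : Function.Bijective (Sum.elim ρ σ)) :
    Fintype.card (Fin k ⊕ Fin d) = n := by
  rw [Fintype.card_of_bijective hb, Fintype.card_fin]

/-- Near a point where `ρ` is a maximal Jacobian minor, the fibres of `f` are graphs with a
uniform Lipschitz constant over the complementary coordinates. -/
lemma exists_nhds_dist_le (hb : Function.Bijective (Sum.elim ρ σ)) {y : E n}
    (hy : polyEval (minor f ρ) y ≠ 0)
    (hmax : ∀ τ, |polyEval (minor f τ) y| ≤ |polyEval (minor f ρ) y|) :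
    ∃ U : Set (E n), IsOpen U ∧ y ∈ U ∧ ∀ a ∈ U, ∀ b ∈ U, polyMap f a = polyMap f b →
      dist a b ≤ (2 * ((k + 1) * d) : ℝ) * dist (proj σ a) (proj σ b) := by
  obtain ⟨e, he⟩ := exists_equiv_jac (card_eq hb) (completed f σ) y (jac_completed_injective hb hy)
  have he' : ∀ v, e v = Sum.elim (jac f y v) (proj σ v) := fun v => by
    rw [← jac_completed, ← he]; rfl
  set C : ℝ := ‖(e.symm : (Fin k ⊕ Fin d → ℝ) →L[ℝ] E n)‖ + 1 with hC
  have hCpos : 0 < C := by positivity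
  have key : ∀ v, ‖v‖ ≤ ((k + 1) * d : ℝ) * ‖proj σ v‖ + C * ‖jac f y v‖ := by
    intro v
    set w := e.symm (Sum.elim (0 : Fin k → ℝ) (proj σ v)) with hw
    have hew : e w = Sum.elim (0 : Fin k → ℝ) (proj σ v) := e.apply_symm_apply _
    rw [he'] at hew
    have hw1 : jac f y w = 0 := funext fun i => congrFun hew (Sum.inl i)
    have hw2 : proj σ w = proj σ v := funext fun i => congrFun hew (Sum.inr i)
    have h1 := norm_tangent_le hb hy hmax hw1
    rw [hw2] at h1
    have h2 : v - w = (e.symm : (Fin k ⊕ Fin d → ℝ) →L[ℝ] E n) (Sum.elim (jac f y v) (0 : Fin d → ℝ)) := by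
      apply e.injective
      rw [ContinuousLinearEquiv.coe_coe, e.apply_symm_apply, he', map_sub, map_sub, hw1, hw2,
        sub_zero, sub_self]
    have h3 : ‖(Sum.elim (jac f y v) 0 : Fin k ⊕ Fin d → ℝ)‖ ≤ ‖jac f y v‖ := by
      refine (pi_norm_le_iff_of_nonneg (norm_nonneg _)).2 fun i => ?_
      cases i with
      | inl i => exact norm_le_pi_norm (jac f y v) i
      | inr m => simp
    have h4 : ‖v - w‖ ≤ C * ‖jac f y v‖ := by
      rw [h2]
      refine (ContinuousLinearMap.le_opNorm _ _).trans ?_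
      exact mul_le_mul (by linarith) h3 (norm_nonneg _) hCpos.le
    calc ‖v‖ = ‖w + (v - w)‖ := by rw [add_sub_cancel]
      _ ≤ ‖w‖ + ‖v - w‖ := norm_add_le _ _
      _ ≤ _ := add_le_add h1 h4
  obtain ⟨U, hU, hUa⟩ := (hasStrictFDerivAt_polyMap f y).approximates_deriv_on_nhds
    (c := (1 / (2 * C)).toNNReal) (Or.inr (Real.toNNReal_pos.2 (by positivity)))
  obtain ⟨V, hVU, hVo, hyV⟩ := mem_nhds_iff.1 hU
  refine ⟨V, hVo, hyV, fun a ha b hb' hab => ?_⟩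
  have h1 := hUa a (hVU ha) b (hVU hb')
  rw [hab, sub_self, zero_sub, norm_neg, Real.coe_toNNReal _ (by positivity)] at h1
  have h2 := key (a - b)
  rw [dist_eq_norm, dist_eq_norm, ← map_sub]
  have h3 : C * ‖jac f y (a - b)‖ ≤ 1 / 2 * ‖a - b‖ := by
    calc C * ‖jac f y (a - b)‖ ≤ C * (1 / (2 * C) * ‖a - b‖) := by gcongr
      _ = 1 / 2 * ‖a - b‖ := by field_simp
  linarith

/-- A countable Lindelöf cover. -/
lemma exists_seq_cover {X : Type*} [TopologicalSpace X] [SecondCountableTopology X]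
    {B : Set X} {P : Set X → Prop} (h0 : P ∅)
    (h : ∀ x ∈ B, ∃ U, IsOpen U ∧ x ∈ U ∧ P U) :
    ∃ U : ℕ → Set X, (∀ i, IsOpen (U i) ∧ P (U i)) ∧ B ⊆ ⋃ i, U i := by
  choose! U hU using h
  obtain ⟨t, htB, htc, ht⟩ := TopologicalSpace.countable_cover_nhdsWithin
    fun x hx => mem_nhdsWithin_of_mem_nhds ((hU x hx).1.mem_nhds (hU x hx).2.1)
  rcases t.eq_empty_or_nonempty with rfl | hne
  · exact ⟨fun _ => ∅, fun _ => ⟨isOpen_empty, h0⟩, by simpa using ht⟩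
  · obtain ⟨u, rfl⟩ := htc.exists_eq_range hne
    refine ⟨fun i => U (u i), fun i => ?_, by simpa using ht⟩
    have := hU (u i) (htB ⟨i, rfl⟩)
    exact ⟨this.1, this.2.2⟩

lemma hausdorffMeasure_maximal_lt_top (hb : Function.Bijective (Sum.elim ρ σ)) {B : Set (E n)}
    (hB : Bornology.IsBounded B)
    (hBM : ∀ x ∈ B, polyMap f x = 0 ∧ polyEval (minor f ρ) x ≠ 0 ∧
      ∀ τ, |polyEval (minor f τ) x| ≤ |polyEval (minor f ρ) x|) :
    μH[(d : ℝ)] B < ⊤ := by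
  classical
  set C : NNReal := 2 * ((k + 1) * d) with hC
  have hCr : (C : ℝ) = 2 * ((k + 1) * d) := by simp [hC]
  obtain ⟨U, hU, hBU⟩ := exists_seq_cover (B := B) (P := fun U => ∀ a ∈ U, ∀ b ∈ U,
    polyMap f a = polyMap f b → dist a b ≤ C * dist (proj σ a) (proj σ b)) (by simp) (by
      intro x hx
      rw [hCr]
      exact exists_nhds_dist_le hb (hBM x hx).2.1 (hBM x hx).2.2)
  obtain ⟨R, hR⟩ := hB.subset_closedBall 0
  obtain ⟨N, hN⟩ := exists_fiber_bound (card_eq hb) (completed f σ)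
  let M : Set (E n) := {x | polyMap f x = 0 ∧ polyEval (minor f ρ) x ≠ 0}
  have hM : MeasurableSet M :=
    ((isClosed_singleton.preimage (contDiff_polyMap f).continuous).measurableSet).inter
      ((isOpen_compl_singleton.preimage (continuous_polyEval (minor f ρ))).measurableSet)
  let D : ℕ → Set (E n) := fun i => (M ∩ Metric.closedBall 0 R) ∩ disjointed U i
  have hDm : ∀ i, MeasurableSet (D i) := fun i =>
    (hM.inter Metric.isClosed_closedBall.measurableSet).inter
      (MeasurableSet.disjointed (fun j => (hU j).1.measurableSet) i)
  have hBD : B ⊆ ⋃ i, D i := by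
    rw [← Set.inter_iUnion, iUnion_disjointed]
    exact fun x hx => ⟨⟨⟨(hBM x hx).1, (hBM x hx).2.1⟩, hR hx⟩, hBU hx⟩
  have hDd : ∀ i, ∀ a ∈ D i, ∀ b ∈ D i, dist a b ≤ C * dist (proj σ a) (proj σ b) :=
    fun i a ha b hb' => (hU i).2 a (disjointed_subset U i ha.2) b (disjointed_subset U i hb'.2)
      (ha.1.1.1.trans hb'.1.1.1.symm)
  have himg : ∀ i, MeasurableSet (proj σ '' D i) := fun i =>
    (hDm i).image_of_continuousOn_injOn (proj σ).continuous.continuousOn fun a ha b hb' hab => by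
      have := hDd i a ha b hb'
      rw [hab, dist_self, mul_zero] at this
      exact dist_le_zero.1 this
  have hvol : (μH[(d : ℝ)] : Measure (Fin d → ℝ)) = volume := by
    have := hausdorffMeasure_pi_real (ι := Fin d)
    rwa [Fintype.card_fin] at this
  have hpt : ∀ y : Fin d → ℝ, ∑' i, (proj σ '' D i).indicator (1 : (Fin d → ℝ) → ℝ≥0∞) y ≤
      (Metric.closedBall (0 : Fin d → ℝ) R).indicator (fun _ => (N : ℝ≥0∞)) y := by
    intro y
    by_cases hy : y ∈ Metric.closedBall (0 : Fin d → ℝ) R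
    · rw [Set.indicator_of_mem hy, ENNReal.tsum_eq_iSup_sum]
      refine iSup_le fun S => ?_
      have hex : ∀ i ∈ S.filter (fun i => y ∈ proj σ '' D i), ∃ x ∈ D i, proj σ x = y :=
        fun i hi => (Finset.mem_filter.1 hi).2
      choose! x hx hxy using hex
      have hsum : ∑ i ∈ S, (proj σ '' D i).indicator (1 : (Fin d → ℝ) → ℝ≥0∞) y =
          ((S.filter (fun i => y ∈ proj σ '' D i)).card : ℝ≥0∞) := by
        rw [Finset.card_filter, Nat.cast_sum]
        refine Finset.sum_congr rfl fun i _ => ?_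
        by_cases h : y ∈ proj σ '' D i
        · rw [Set.indicator_of_mem h, if_pos h]; simp
        · rw [Set.indicator_of_notMem h, if_neg h]; simp
      rw [hsum, Nat.cast_le]
      have hinj : Set.InjOn x (S.filter (fun i => y ∈ proj σ '' D i)) := by
        intro i hi j hj hij
        by_contra hne
        refine Set.disjoint_left.1 (disjoint_disjointed U hne) (hx i hi).2 ?_
        rw [hij]
        exact (hx j hj).2
      rw [← Finset.card_image_of_injOn hinj]
      refine hN (Sum.elim 0 y) _ fun z hz => ?_
      obtain ⟨i, hi, rfl⟩ := Finset.mem_image.1 hz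
      have hMi := (hx i hi).1.1
      exact ⟨by rw [polyMap_completed, hMi.1, hxy i hi], jac_completed_injective hb hMi.2⟩
    · rw [Set.indicator_of_notMem hy, nonpos_iff_eq_zero, ENNReal.tsum_eq_zero]
      refine fun i => Set.indicator_of_notMem ?_ _
      rintro ⟨x, hx, rfl⟩
      refine hy ?_
      have := hx.1.2
      rw [mem_closedBall_zero_iff] at this ⊢
      exact (norm_proj_le σ x).trans this
  have hsum : ∑' i, volume (proj σ '' D i) < ⊤ := by
    calc ∑' i, volume (proj σ '' D i)
        = ∑' i, ∫⁻ y, (proj σ '' D i).indicator (1 : (Fin d → ℝ) → ℝ≥0∞) y := by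
          simp_rw [lintegral_indicator_one (himg _)]
      _ = ∫⁻ y, ∑' i, (proj σ '' D i).indicator (1 : (Fin d → ℝ) → ℝ≥0∞) y :=
          (lintegral_tsum fun i => (measurable_one.indicator (himg i)).aemeasurable).symm
      _ ≤ ∫⁻ y, (Metric.closedBall (0 : Fin d → ℝ) R).indicator (fun _ => (N : ℝ≥0∞)) y :=
          lintegral_mono hpt
      _ = N * volume (Metric.closedBall (0 : Fin d → ℝ) R) :=
          lintegral_indicator_const Metric.isClosed_closedBall.measurableSet _
      _ < ⊤ := ENNReal.mul_lt_top (by simp) measure_closedBall_lt_top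
  calc μH[(d : ℝ)] B ≤ μH[(d : ℝ)] (⋃ i, D i) := measure_mono hBD
    _ ≤ ∑' i, μH[(d : ℝ)] (D i) := measure_iUnion_le _
    _ ≤ ∑' i, (C : ℝ≥0∞) ^ (d : ℝ) * volume (proj σ '' D i) := ENNReal.tsum_le_tsum fun i => by
        rw [← hvol]
        exact hausdorffMeasure_le_image_of_dist_le (hDd i) (Nat.cast_nonneg d)
    _ = (C : ℝ≥0∞) ^ (d : ℝ) * ∑' i, volume (proj σ '' D i) := ENNReal.tsum_mul_left
    _ < ⊤ := ENNReal.mul_lt_top (ENNReal.rpow_lt_top_of_nonneg (Nat.cast_nonneg d) (by simp)) hsum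

/-- A bounded set of nondegenerate zeros of `k` polynomials in `n` variables has finite
`(n - k)`-dimensional Hausdorff measure. -/
lemma hausdorffMeasure_regular_lt_top (f : Fin k → MvPolynomial (Fin n) ℝ) {B : Set (E n)}
    (hB : Bornology.IsBounded B)
    (hBM : ∀ x ∈ B, polyMap f x = 0 ∧ ∃ ρ, polyEval (minor f ρ) x ≠ 0) :
    μH[((n - k : ℕ) : ℝ)] B < ⊤ := by
  let P : (Fin k → Fin n) → Set (E n) := fun ρ => {x ∈ B | polyEval (minor f ρ) x ≠ 0 ∧
      ∀ τ, |polyEval (minor f τ) x| ≤ |polyEval (minor f ρ) x|}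
  have hcover : B ⊆ ⋃ ρ, P ρ := by
    intro x hx
    obtain ⟨hx0, ρ₀, hρ₀⟩ := hBM x hx
    have : Nonempty (Fin k → Fin n) := ⟨ρ₀⟩
    obtain ⟨ρ, hρ⟩ := Finite.exists_max fun τ => |polyEval (minor f τ) x|
    exact Set.mem_iUnion.2 ⟨ρ, hx, abs_pos.1 ((abs_pos.2 hρ₀).trans_le (hρ ρ₀)), hρ⟩
  refine (measure_mono hcover).trans_lt ((measure_iUnion_le _).trans_lt ?_)
  rw [tsum_fintype]
  refine ENNReal.sum_lt_top.2 fun ρ _ => ?_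
  rcases (P ρ).eq_empty_or_nonempty with h | ⟨x, hx⟩
  · simp [h]
  have hinj : Function.Injective ρ := minor_injective (f := f) fun h => hx.2.1 (by
    simp [h, polyEval])
  obtain ⟨σ, hσ⟩ := exists_complement ρ hinj
  exact hausdorffMeasure_maximal_lt_top hσ (hB.subset fun x hx => hx.1)
    fun x hx => ⟨(hBM x hx.1).1, hx.2⟩

/-- A chart of the manifold of nondegenerate zeros of `f`. -/
lemma exists_chart (hb : Function.Bijective (Sum.elim ρ σ)) {y : E n} (hy0 : polyMap f y = 0)
    (hy : polyEval (minor f ρ) y ≠ 0) {W : Set (E n)} (hW : W ∈ 𝓝 y) :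
    ∃ (U : Set (E d)) (g : E d → E n) (u₀ : E d), IsOpen U ∧ Convex ℝ U ∧ u₀ ∈ U ∧ g u₀ = y ∧
      ContDiffOn ℝ 1 g U ∧ Set.InjOn g U ∧ (∀ u ∈ U, Function.Injective (fderiv ℝ g u)) ∧
      (∀ u ∈ U, g u ∈ W ∧ polyMap f (g u) = 0) ∧
      ∃ O, IsOpen O ∧ y ∈ O ∧ ∀ x ∈ O, polyMap f x = 0 → x ∈ g '' U := by
  obtain ⟨e, he⟩ := exists_equiv_jac (card_eq hb) (completed f σ) y (jac_completed_injective hb hy)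
  have hcd : ContDiffAt ℝ 1 (polyMap (completed f σ)) y := (contDiff_polyMap _).contDiffAt
  have hd : HasFDerivAt (polyMap (completed f σ)) (e : E n →L[ℝ] (Fin k ⊕ Fin d → ℝ)) y := by
    rw [he]; exact hasFDerivAt_polyMap _ y
  set φ := hcd.toOpenPartialHomeomorph (polyMap (completed f σ)) hd one_ne_zero with hφ
  have hφc : ∀ x, φ x = Sum.elim (polyMap f x) (proj σ x) := fun x => polyMap_completed f σ x
  have hys : y ∈ φ.source := hcd.mem_toOpenPartialHomeomorph_source hd one_ne_zero
  have hinv : ContDiffAt ℝ 1 φ.symm (φ y) := hcd.to_localInverse hd one_ne_zero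
  let j : E d →L[ℝ] (Fin k ⊕ Fin d → ℝ) :=
    ContinuousLinearMap.pi (Sum.elim (fun _ => 0) fun m => coordL m)
  have hj : ∀ u : E d, j u = Sum.elim (0 : Fin k → ℝ) (fun m => u m) := fun u => by
    funext i; cases i <;> rfl
  let q : E n → E d := fun x => WithLp.toLp 2 (proj σ x)
  have hq : Continuous q := (PiLp.continuous_toLp 2 _).comp (proj σ).continuous
  have hjq : ∀ x, polyMap f x = 0 → j (q x) = φ x := fun x hx => by rw [hj, hφc, hx]
  have hev : ∀ᶠ z in 𝓝 (φ y), z ∈ φ.target ∧ ContDiffAt ℝ 1 φ.symm z ∧ φ.symm z ∈ W := by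
    refine (φ.open_target.eventually_mem (φ.map_source hys)).and
      ((hinv.eventually (by simp)).and ?_)
    have := hinv.continuousAt
    refine this.eventually_mem ?_
    rwa [φ.left_inv hys]
  rw [← hjq y hy0] at hev
  obtain ⟨r, hr, hball⟩ :=
    Metric.eventually_nhds_iff_ball.1 (j.continuous.continuousAt.eventually hev)
  have hright : ∀ u ∈ Metric.ball (q y) r, φ (φ.symm (j u)) = j u := fun u hu =>
    φ.right_inv (hball u hu).1
  have hf0 : ∀ u ∈ Metric.ball (q y) r, polyMap f (φ.symm (j u)) = 0 := fun u hu => by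
    have := hright u hu
    rw [hφc, hj u] at this
    exact funext fun i => by simpa [hj u] using congrFun this (Sum.inl i)
  have hpu : ∀ u ∈ Metric.ball (q y) r, proj σ (φ.symm (j u)) = fun m => u m := fun u hu => by
    have := hright u hu
    rw [hφc, hj u] at this
    exact funext fun i => by simpa [hj u] using congrFun this (Sum.inr i)
  have hcda : ∀ u ∈ Metric.ball (q y) r, ContDiffAt ℝ 1 (fun u => φ.symm (j u)) u := fun u hu =>
    ContDiffAt.comp u (hball u hu).2.1 j.contDiff.contDiffAt
  refine ⟨Metric.ball (q y) r, fun u => φ.symm (j u), q y, Metric.isOpen_ball, convex_ball _ _,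
    Metric.mem_ball_self hr, ?_, fun u hu => (hcda u hu).contDiffWithinAt, ?_, ?_,
    fun u hu => ⟨(hball u hu).2.2, hf0 u hu⟩, φ.source ∩ q ⁻¹' Metric.ball (q y) r,
    φ.open_source.inter (Metric.isOpen_ball.preimage hq), ⟨hys, Metric.mem_ball_self hr⟩, ?_⟩
  · show φ.symm (j (q y)) = y
    rw [hjq y hy0, φ.left_inv hys]
  · intro u hu v hv huv
    have : proj σ (φ.symm (j u)) = proj σ (φ.symm (j v)) := congrArg _ huv
    rw [hpu u hu, hpu v hv] at this
    ext m
    exact congrFun this m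
  · intro u hu
    have h1 := (proj σ).hasFDerivAt.comp u
      ((hcda u hu).differentiableAt one_ne_zero).hasFDerivAt
    have h2 : HasFDerivAt (fun u : E d => (fun m => u m : Fin d → ℝ))
        (ContinuousLinearMap.pi fun m => coordL m) u :=
      (ContinuousLinearMap.pi fun m : Fin d => coordL m).hasFDerivAt
    have h3 := h1.unique (h2.congr_of_eventuallyEq
      (Filter.eventuallyEq_of_mem (Metric.isOpen_ball.mem_nhds hu) hpu))
    rw [injective_iff_map_eq_zero]
    intro v hv
    have h4 := DFunLike.congr_fun h3 v
    rw [ContinuousLinearMap.comp_apply, hv, map_zero] at h4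
    ext m
    exact (congrFun h4 m).symm
  · rintro x ⟨hxs, hxq⟩ hx0
    refine ⟨q x, hxq, ?_⟩
    show φ.symm (j (q x)) = x
    rw [hjq x hx0, φ.left_inv hxs]

/-- If the ideal of `F` is stable under differentiation along the zeros of `f`, then `F` vanishes on
a relatively open set of nondegenerate zeros of `f`. -/
lemma exists_nhds_vanishing [Fintype ι] (hb : Function.Bijective (Sum.elim ρ σ))
    (F : ι → MvPolynomial (Fin n) ℝ)
    (hF : ∀ i j, minor (Fin.snoc f (F i) : Fin (k + 1) → MvPolynomial (Fin n) ℝ)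
      (Fin.snoc ρ j : Fin (k + 1) → Fin n) ∈ Ideal.span (Set.range F))
    {y : E n} (hy0 : polyMap f y = 0) (hy : polyEval (minor f ρ) y ≠ 0) (hyF : polyMap F y = 0) :
    ∃ O, IsOpen O ∧ y ∈ O ∧ ∀ x ∈ O, polyMap f x = 0 → polyMap F x = 0 := by
  have hW : {x | polyEval (minor f ρ) x ≠ 0} ∈ 𝓝 y :=
    (isOpen_compl_singleton.preimage (continuous_polyEval (minor f ρ))).mem_nhds hy
  obtain ⟨U, g, u₀, hU, hUc, hu₀, hgu₀, hg, -, -, hgW, O, hO, hyO, hOg⟩ := exists_chart hb hy0 hy hW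
  refine ⟨O, hO, hyO, fun x hx hx0 => ?_⟩
  obtain ⟨u, hu, rfl⟩ := hOg x hx hx0
  choose a ha using fun i j => (Ideal.mem_span_range_iff_exists_fun).1 (hF i j)
  set ℓ : ℝ → E d := fun t => u₀ + t • (u - u₀) with hℓ
  have hℓU : ∀ t ∈ Set.Icc (0 : ℝ) 1, ℓ t ∈ U := fun t ht =>
    hUc.add_smul_sub_mem hu₀ hu ht
  have hℓc : Continuous ℓ := by fun_prop
  have hℓd : ∀ t, HasDerivAt ℓ (u - u₀) t := fun t => by
    simpa [hℓ] using ((hasDerivAt_id t).smul_const (u - u₀)).const_add u₀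
  set γ' : ℝ → E n := fun t => fderiv ℝ g (ℓ t) (u - u₀) with hγ'
  have hgd : ∀ t ∈ Set.Icc (0 : ℝ) 1, HasFDerivAt g (fderiv ℝ g (ℓ t)) (ℓ t) := fun t ht =>
    ((hg.contDiffAt (hU.mem_nhds (hℓU t ht))).differentiableAt one_ne_zero).hasFDerivAt
  have hγ : ∀ t ∈ Set.Icc (0 : ℝ) 1, HasDerivAt (fun t => g (ℓ t)) (γ' t) t := fun t ht =>
    (hgd t ht).comp_hasDerivAt t (hℓd t)
  have hγc : ContinuousOn (fun t => g (ℓ t)) (Set.Icc 0 1) := fun t ht =>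
    (hγ t ht).continuousAt.continuousWithinAt
  have hγ'c : ContinuousOn γ' (Set.Icc 0 1) :=
    ((hg.continuousOn_fderiv_of_isOpen hU le_rfl).comp hℓc.continuousOn hℓU).clm_apply
      continuousOn_const
  have htan : ∀ t ∈ Set.Icc (0 : ℝ) 1, jac f (g (ℓ t)) (γ' t) = 0 := by
    intro t ht
    have h1 := (hasFDerivAt_polyMap f (g (ℓ t))).comp (ℓ t) (hgd t ht)
    have h2 : HasFDerivAt (polyMap f ∘ g) (0 : E d →L[ℝ] (Fin k → ℝ)) (ℓ t) :=
      (hasFDerivAt_const (0 : Fin k → ℝ) (ℓ t)).congr_of_eventuallyEq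
        (Filter.eventuallyEq_of_mem (hU.mem_nhds (hℓU t ht)) fun v hv => (hgW v hv).2)
    have h3 := DFunLike.congr_fun (h1.unique h2) (u - u₀)
    exact h3
  let c : ι → ℝ → ℝ := fun i t => |(polyEval (minor f ρ) (g (ℓ t)))⁻¹| *
    ∑ j, |γ' t j| * ∑ l, |polyEval (a i j l) (g (ℓ t))|
  have hc0 : ∀ i t, 0 ≤ c i t := fun i t => by positivity
  have hcc : ContinuousOn (fun t => ∑ i, c i t) (Set.Icc 0 1) := by
    refine continuousOn_finsetSum _ fun i _ => ?_
    refine ContinuousOn.mul (ContinuousOn.abs (ContinuousOn.inv₀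
      ((continuous_polyEval _).comp_continuousOn hγc) fun t ht => (hgW _ (hℓU t ht)).1)) ?_
    refine continuousOn_finsetSum _ fun j _ => ContinuousOn.mul ?_ ?_
    · exact ((coordL j).continuous.comp_continuousOn hγ'c).abs
    · exact continuousOn_finsetSum _ fun l _ =>
        ((continuous_polyEval _).comp_continuousOn hγc).abs
  obtain ⟨K, hK⟩ := (isCompact_Icc.image_of_continuousOn hcc).bddAbove
  have hcK : ∀ t ∈ Set.Icc (0 : ℝ) 1, ∀ i, c i t ≤ K := fun t ht i =>
    (Finset.single_le_sum (fun i _ => hc0 i t) (Finset.mem_univ i)).trans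
      (hK ⟨t, ht, rfl⟩)
  have hder : ∀ t ∈ Set.Icc (0 : ℝ) 1,
      HasDerivAt (fun t => polyMap F (g (ℓ t))) (jac F (g (ℓ t)) (γ' t)) t := fun t ht =>
    (hasFDerivAt_polyMap F _).comp_hasDerivAt t (hγ t ht)
  have hbound : ∀ t ∈ Set.Icc (0 : ℝ) 1,
      ‖jac F (g (ℓ t)) (γ' t)‖ ≤ K * ‖polyMap F (g (ℓ t))‖ := by
    intro t ht
    have hK0 : 0 ≤ K * ‖polyMap F (g (ℓ t))‖ := by
      rcases isEmpty_or_nonempty ι with hι | ⟨⟨i⟩⟩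
      · rw [Subsingleton.elim (polyMap F (g (ℓ t))) 0, norm_zero, mul_zero]
      · exact mul_nonneg ((hc0 i t).trans (hcK t ht i)) (norm_nonneg _)
    refine (pi_norm_le_iff_of_nonneg hK0).2 fun i => ?_
    refine le_trans ?_ (mul_le_mul_of_nonneg_right (hcK t ht i) (norm_nonneg _))
    have hΔ : polyEval (minor f ρ) (g (ℓ t)) ≠ 0 := (hgW _ (hℓU t ht)).1
    have h1 := sum_mul_minor_snoc f ρ (F i) (g (ℓ t)) (γ' t) (htan t ht)
    have h2 : jac F (g (ℓ t)) (γ' t) i = (polyEval (minor f ρ) (g (ℓ t)))⁻¹ *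
        ∑ j, γ' t j * ∑ l, polyEval (a i j l) (g (ℓ t)) * polyMap F (g (ℓ t)) l := by
      rw [jac_apply, eq_inv_mul_iff_mul_eq₀ hΔ, ← h1]
      refine Finset.sum_congr rfl fun j _ => ?_
      rw [← ha i j]
      simp [polyEval, polyMap]
    rw [h2, Real.norm_eq_abs, abs_mul, mul_assoc, Finset.sum_mul]
    refine mul_le_mul_of_nonneg_left ((Finset.abs_sum_le_sum_abs _ _).trans ?_) (abs_nonneg _)
    refine Finset.sum_le_sum fun j _ => ?_
    rw [abs_mul, mul_assoc, Finset.sum_mul]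
    refine mul_le_mul_of_nonneg_left ((Finset.abs_sum_le_sum_abs _ _).trans ?_) (abs_nonneg _)
    refine Finset.sum_le_sum fun l _ => ?_
    rw [abs_mul]
    exact mul_le_mul_of_nonneg_left (norm_le_pi_norm (polyMap F (g (ℓ t))) l) (abs_nonneg _)
  have hzero := eq_zero_of_abs_deriv_le_mul_abs_self_of_eq_zero_right
    (f := fun t => polyMap F (g (ℓ t))) (f' := fun t => jac F (g (ℓ t)) (γ' t)) (K := K)
    (a := 0) (b := 1) (fun t ht => (hder t ht).continuousAt.continuousWithinAt)
    (fun t ht => (hder t (Set.Ico_subset_Icc_self ht)).hasDerivWithinAt)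
    (by simp [hℓ, hgu₀, hyF]) (fun t ht => hbound t (Set.Ico_subset_Icc_self ht))
    1 (by simp)
  simpa [hℓ] using hzero

lemma le_sDim {C : Set (E n)} {U : Set (E d)} (hU : IsOpen U) (hne : U.Nonempty) {g : E d → E n}
    (hg : ContDiffOn ℝ 1 g U) (hi : Set.InjOn g U)
    (hd : ∀ x ∈ U, Function.Injective (fderiv ℝ g x)) (hC : g '' U ⊆ C) : d ≤ sDim C := by
  refine le_csSup ⟨n, ?_⟩ ⟨U, hU, hne, g, hg, hi, hd, hC⟩
  rintro m ⟨V, -, ⟨x, hx⟩, h, -, -, hh, -⟩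
  simpa using LinearMap.finrank_le_finrank_of_injective (f := (fderiv ℝ h x).toLinearMap) (hh x hx)

/-- Finiteness of the measure for the pieces of a stratification by nondegenerate zero sets. -/
lemma hausdorffMeasure_stratum_lt_top {C : Set (E n)} (hC : Bornology.IsBounded C) (m : ℕ) :
    ∀ (k : ℕ), k + m = n + 1 →
      ∀ (f : Fin k → MvPolynomial (Fin n) ℝ) (ρ : Fin k → Fin n)
        (I : Ideal (MvPolynomial (Fin n) ℝ)) {W : Set (E n)}, IsOpen W →
      {x | polyMap f x = 0 ∧ polyEval (minor f ρ) x ≠ 0 ∧ (∀ p ∈ I, polyEval p x = 0) ∧ x ∈ W} ⊆ C →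
      μH[(sDim C : ℝ)] {x | polyMap f x = 0 ∧ polyEval (minor f ρ) x ≠ 0 ∧
        (∀ p ∈ I, polyEval p x = 0) ∧ x ∈ W} < ⊤ := by
  have hempty : ∀ {k : ℕ} {f : Fin k → MvPolynomial (Fin n) ℝ} {ρ : Fin k → Fin n} {x : E n},
      polyEval (minor f ρ) x ≠ 0 → Function.Injective ρ := fun {k f ρ x} hx =>
    minor_injective (f := f) fun h => hx (by simp [h, polyEval])
  induction m with
  | zero =>
    intro k hk f ρ I W _ _
    convert! (measure_empty (μ := μH[(sDim C : ℝ)])).trans_lt ENNReal.zero_lt_top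
    refine Set.eq_empty_of_forall_notMem fun x hx => ?_
    have := Fintype.card_le_of_injective ρ (hempty hx.2.1)
    simp only [Fintype.card_fin] at this
    omega
  | succ m ih =>
    intro k hk f ρ I
    induction I using IsNoetherian.induction with
    | hgt I hI =>
    intro W hW hBC
    set B := {x | polyMap f x = 0 ∧ polyEval (minor f ρ) x ≠ 0 ∧ (∀ p ∈ I, polyEval p x = 0) ∧
      x ∈ W} with hB
    rcases B.eq_empty_or_nonempty with he | ⟨y, hy⟩
    · simp [he]
    obtain ⟨σ, hσ⟩ := exists_complement ρ (hempty hy.2.1)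
    obtain ⟨H, hH⟩ := (isNoetherian_def.1 inferInstance I : I.FG)
    let T : MvPolynomial (Fin n) ℝ → Fin n → MvPolynomial (Fin n) ℝ := fun h j =>
      minor (Fin.snoc f h : Fin (k + 1) → MvPolynomial (Fin n) ℝ)
        (Fin.snoc ρ j : Fin (k + 1) → Fin n)
    by_cases hT : ∀ h ∈ H, ∀ j, T h j ∈ I
    · let F : H → MvPolynomial (Fin n) ℝ := Subtype.val
      have hrange : Ideal.span (Set.range F) = I := by
        rw [Subtype.range_coe]; exact hH
      have hFI : ∀ x, polyMap F x = 0 → ∀ p ∈ I, polyEval p x = 0 := by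
        intro x hx p hp
        have hle : I ≤ RingHom.ker (MvPolynomial.eval fun i => x i) := by
          rw [← hrange, Ideal.span_le]
          rintro _ ⟨h, rfl⟩
          exact congrFun hx h
        exact hle hp
      have hyF : polyMap F y = 0 := funext fun h => hy.2.2.1 h (hH ▸ Ideal.subset_span h.2)
      obtain ⟨O, hO, hyO, hOF⟩ := exists_nhds_vanishing hσ F
        (fun h j => by rw [hrange]; exact hT h h.2 j) hy.1 hy.2.1 hyF
      have hnhds : (O ∩ W) ∩ {x | polyEval (minor f ρ) x ≠ 0} ∈ 𝓝 y :=
        ((hO.inter hW).inter (isOpen_compl_singleton.preimage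
          (continuous_polyEval (minor f ρ)))).mem_nhds ⟨⟨hyO, hy.2.2.2⟩, hy.2.1⟩
      obtain ⟨U, g, u₀, hU, -, hu₀, -, hg, hgi, hgd, hgW, -⟩ := exists_chart hσ hy.1 hy.2.1 hnhds
      have hle : n - k ≤ sDim C := by
        refine le_sDim hU ⟨u₀, hu₀⟩ hg hgi hgd ?_
        rintro _ ⟨u, hu, rfl⟩
        obtain ⟨⟨⟨h1, h2⟩, h3⟩, h4⟩ := hgW u hu
        exact hBC ⟨h4, h3, hFI _ (hOF _ h1 h4), h2⟩
      exact (Measure.hausdorffMeasure_mono (by exact_mod_cast hle) B).trans_lt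
        (hausdorffMeasure_regular_lt_top f (hC.subset hBC) fun x hx => ⟨hx.1, ρ, hx.2.1⟩)
    · push Not at hT
      obtain ⟨h₁, hh₁, j₁, hhj₁⟩ := hT
      set J : Ideal (MvPolynomial (Fin n) ℝ) := I ⊔ Ideal.span {T h₁ j₁} with hJ
      have hIJ : I < J := by
        refine lt_of_le_of_ne le_sup_left fun h => hhj₁ ?_
        rw [h]
        exact Ideal.mem_sup_right (Ideal.mem_span_singleton_self _)
      have hIJ' : ∀ x, (∀ p ∈ I, polyEval p x = 0) → polyEval (T h₁ j₁) x = 0 →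
          ∀ p ∈ J, polyEval p x = 0 := by
        intro x hx hx' p hp
        have hle : J ≤ RingHom.ker (MvPolynomial.eval fun i => x i) :=
          sup_le (fun q hq => hx q hq) (by
            rw [Ideal.span_le, Set.singleton_subset_iff]; exact hx')
        exact hle hp
      have hsub : B ⊆ {x | polyMap f x = 0 ∧ polyEval (minor f ρ) x ≠ 0 ∧
            (∀ p ∈ J, polyEval p x = 0) ∧ x ∈ W} ∪
          {x | polyMap (Fin.snoc f h₁ : Fin (k + 1) → MvPolynomial (Fin n) ℝ) x = 0 ∧
            polyEval (T h₁ j₁) x ≠ 0 ∧ (∀ p ∈ I, polyEval p x = 0) ∧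
            x ∈ W ∩ {x | polyEval (minor f ρ) x ≠ 0}} := by
        intro x hx
        by_cases hx' : polyEval (T h₁ j₁) x = 0
        · exact Or.inl ⟨hx.1, hx.2.1, hIJ' x hx.2.2.1 hx', hx.2.2.2⟩
        · refine Or.inr ⟨funext fun i => ?_, hx', hx.2.2.1, hx.2.2.2, hx.2.1⟩
          induction i using Fin.lastCases with
          | last => simpa [polyMap] using hx.2.2.1 h₁ (hH ▸ Ideal.subset_span hh₁)
          | cast i => simpa [polyMap] using congrFun hx.1 i
      refine (measure_mono hsub).trans_lt (measure_union_lt_top ?_ ?_)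
      · exact hI J hIJ hW fun x hx => hBC
          ⟨hx.1, hx.2.1, fun p hp => hx.2.2.1 p (hIJ.le hp), hx.2.2.2⟩
      · refine ih (k + 1) (by omega) _ _ I (hW.inter (isOpen_compl_singleton.preimage
          (continuous_polyEval (minor f ρ)))) fun x hx => hBC
          ⟨funext fun i => ?_, hx.2.2.2.2, hx.2.2.1, hx.2.2.2.1⟩
        simpa [polyMap] using congrFun hx.1 i.castSucc

lemma exists_sign_determined {s : Set (E n)} (hs : IsSemialgebraic n s) :
    ∃ A : Finset (MvPolynomial (Fin n) ℝ), ∀ x y : E n,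
      (∀ p ∈ A, SignType.sign (polyEval p x) = SignType.sign (polyEval p y)) → (x ∈ s ↔ y ∈ s) := by
  classical
  induction hs with
  | basic p =>
    refine ⟨{p}, fun x y h => ?_⟩
    have h := h p (Finset.mem_singleton_self p)
    change 0 ≤ polyEval p x ↔ 0 ≤ polyEval p y
    rw [← sign_nonneg_iff, h, sign_nonneg_iff]
  | compl _ ih =>
    obtain ⟨A, hA⟩ := ih
    exact ⟨A, fun x y h => not_congr (hA x y h)⟩
  | union _ _ ih₁ ih₂ =>
    obtain ⟨A, hA⟩ := ih₁
    obtain ⟨B, hB⟩ := ih₂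
    exact ⟨A ∪ B, fun x y h => or_congr
      (hA x y fun p hp => h p (Finset.mem_union_left _ hp))
      (hB x y fun p hp => h p (Finset.mem_union_right _ hp))⟩

/-- A bounded semialgebraic set has finite Hausdorff measure in its own dimension. -/
lemma hausdorffMeasure_sDim_lt_top {C : Set (E n)} (hs : IsSemialgebraic n C)
    (hC : Bornology.IsBounded C) : μH[(sDim C : ℝ)] C < ⊤ := by
  obtain ⟨A, hA⟩ := exists_sign_determined hs
  let cell : (A → SignType) → Set (E n) := fun ε =>
    {x | x ∈ C ∧ ∀ p : A, SignType.sign (polyEval p.1 x) = ε p}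
  have hcover : C ⊆ ⋃ ε, cell ε := fun x hx =>
    Set.mem_iUnion.2 ⟨fun p => SignType.sign (polyEval p.1 x), hx, fun _ => rfl⟩
  refine (measure_mono hcover).trans_lt ((measure_iUnion_le _).trans_lt ?_)
  rw [tsum_fintype]
  refine ENNReal.sum_lt_top.2 fun ε _ => ?_
  rcases (cell ε).eq_empty_or_nonempty with h | ⟨y, hyC, hy⟩
  · simp [h]
  have hsub : ∀ x, (∀ p : A, SignType.sign (polyEval p.1 x) = ε p) → x ∈ C := fun x hx =>
    (hA x y fun p hp => (hx ⟨p, hp⟩).trans (hy ⟨p, hp⟩).symm).2 hyC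
  let I : Ideal (MvPolynomial (Fin n) ℝ) := Ideal.span {p | ∃ h : p ∈ A, ε ⟨p, h⟩ = 0}
  let W : Set (E n) := ⋂ p : A, {x | ε p ≠ 0 → SignType.sign (polyEval p.1 x) = ε p}
  have hW : IsOpen W := by
    refine isOpen_iInter_of_finite fun p => ?_
    rcases hε : ε p with _ | _ | _
    · simp
    · simpa [sign_eq_neg_one_iff] using!
        (isOpen_Iio (a := (0 : ℝ))).preimage (continuous_polyEval p.1)
    · simpa [sign_eq_one_iff] using!
        (isOpen_Ioi (a := (0 : ℝ))).preimage (continuous_polyEval p.1)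
  have hZ : ∀ x, (∀ p ∈ I, polyEval p x = 0) → x ∈ W →
      ∀ p : A, SignType.sign (polyEval p.1 x) = ε p := by
    intro x hx hxW p
    by_cases h0 : ε p = 0
    · rw [h0, sign_eq_zero_iff]
      exact hx p (Ideal.subset_span ⟨p.2, h0⟩)
    · exact Set.mem_iInter.1 hxW p h0
  refine (measure_mono ?_).trans_lt (hausdorffMeasure_stratum_lt_top hC (n + 1) 0 (by omega)
    (fun i => i.elim0) (fun i => i.elim0) I hW fun x hx => hsub x (hZ x hx.2.2.1 hx.2.2.2))
  rintro x ⟨-, hx⟩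
  refine ⟨funext fun i => i.elim0, ?_, fun p hp => ?_, ?_⟩
  · simp [minor, polyEval]
  · have hle : I ≤ RingHom.ker (MvPolynomial.eval fun i => x i) := by
      rw [Ideal.span_le]
      rintro q ⟨hq, h0⟩
      exact sign_eq_zero_iff.1 ((hx ⟨q, hq⟩).trans h0)
    exact hle hp
  · exact Set.mem_iInter.2 fun p _ => hx p

end Semialg

theorem stmt15 (n e : ℕ) (he : e ≤ n) :
    (∀ C : Set (E n), IsSemialgebraic n C → Bornology.IsBounded C →
      sDim C < e → μH[(e : ℝ)] C = 0) ∧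
    (∀ C : Set (E n), IsSemialgebraic n C → Bornology.IsBounded C →
      sDim C ≤ e → μH[(e : ℝ)] C < ⊤) := by
  refine ⟨fun C hs hC hd => ?_, fun C hs hC hd => ?_⟩
  · exact (Measure.hausdorffMeasure_zero_or_top (Nat.cast_lt.2 hd) C).resolve_right
      (Semialg.hausdorffMeasure_sDim_lt_top hs hC).ne
  · exact (Measure.hausdorffMeasure_mono (Nat.cast_le.2 hd) C).trans_lt
      (Semialg.hausdorffMeasure_sDim_lt_top hs hC)
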